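/- Let α ∈ (0,1], T > 0, and let f : [0,T] × ℝ → ℝ be continuous, satisfy the Lipschitz condition, and satisfy f(t,0) = 0 for all t ∈ [0,T]. Let x₀ < 0 and let φ(·, x₀) be the solution on [0,T] of the Caputo fractional initial value problem with initial value x₀. Then for all t ∈ [0,T]: x₀ · E_α(a^*(t) t^α) ≤ φ(t, x₀) ≤ x₀ · E_α(a_*(t) t^α), where a_*(t) := inf_{s ∈ [0,t], x ≠ 0} f(s,x)/x and a^*(t) := sup_{s ∈ [0,t], x ≠ 0} f(s,x)/x. -/

import Mathlib

open Set intervalIntegral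

/-- The one-parameter Mittag-Leffler function `E_α(x) = ∑_{k=0}^∞ x^k / Γ(αk+1)`. -/
noncomputable def mittagLeffler (α x : ℝ) : ℝ :=
  ∑' k : ℕ, x ^ k / Real.Gamma (α * (k : ℝ) + 1)

/-- A continuous function `x` on `[0,T]` solves the Caputo fractional initial value
problem `^C D^α_{0+} x(t) = f(t,x(t))`, `x(0) = x₀`, in the equivalent Volterra
integral formulation. -/
def IsCaputoSolution (α T : ℝ) (f : ℝ → ℝ → ℝ) (x₀ : ℝ) (x : ℝ → ℝ) : Prop :=
  ContinuousOn x (Set.Icc 0 T) ∧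
    ∀ t ∈ Set.Icc 0 T,
      x t = x₀ + (1 / Real.Gamma α) * ∫ s in (0:ℝ)..t, (t - s) ^ (α - 1) * f s (x s)

/-- `a_*(t) = inf_{s ∈ [0,t], x ≠ 0} f(s,x)/x`. -/
noncomputable def aLow (f : ℝ → ℝ → ℝ) (t : ℝ) : ℝ :=
  sInf {y | ∃ s ∈ Set.Icc 0 t, ∃ x : ℝ, x ≠ 0 ∧ y = f s x / x}

/-- `a^*(t) = sup_{s ∈ [0,t], x ≠ 0} f(s,x)/x`. -/
noncomputable def aHigh (f : ℝ → ℝ → ℝ) (t : ℝ) : ℝ :=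
  sSup {y | ∃ s ∈ Set.Icc 0 t, ∃ x : ℝ, x ≠ 0 ∧ y = f s x / x}

open MeasureTheory

/-- The two-parameter Mittag-Leffler function `E_{α,β}(z) = ∑_{k=0}^∞ z^k / Γ(αk+β)`. -/
noncomputable def mittagLeffler₂ (α β z : ℝ) : ℝ :=
  ∑' k : ℕ, z ^ k / Real.Gamma (α * (k : ℝ) + β)

lemma rpow_sub_one_mul_exp_le_Gamma {M x : ℝ} (hM : 0 < M) (hx : 1 ≤ x) :
    M ^ (x - 1) * Real.exp (-(M + 1)) ≤ Real.Gamma x := by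
  have hx0 : 0 < x := by linarith
  have hint := Real.GammaIntegral_convergent hx0
  have hsub : Ioc M (M + 1) ⊆ Ioi 0 := fun y hy => hM.trans hy.1
  rw [Real.Gamma_eq_integral hx0]
  calc M ^ (x - 1) * Real.exp (-(M + 1))
      = ∫ _ in Ioc M (M + 1), M ^ (x - 1) * Real.exp (-(M + 1)) := by simp
    _ ≤ ∫ y in Ioc M (M + 1), Real.exp (-y) * y ^ (x - 1) := by
        refine setIntegral_mono_on (integrableOn_const (by simp)) (hint.mono_set hsub) measurableSet_Ioc ?_
        intro y hy
        rw [mul_comm]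
        have h1 : M ^ (x - 1) ≤ y ^ (x - 1) :=
          Real.rpow_le_rpow hM.le hy.1.le (by linarith)
        have h2 : Real.exp (-(M + 1)) ≤ Real.exp (-y) := Real.exp_le_exp.2 (by linarith [hy.2])
        exact mul_le_mul h2 h1 (by positivity) (by positivity)
    _ ≤ ∫ y in Ioi 0, Real.exp (-y) * y ^ (x - 1) := by
        refine setIntegral_mono_set hint ?_ hsub.eventuallyLE
        filter_upwards [ae_restrict_mem measurableSet_Ioi] with y hy
        have : (0 : ℝ) < y := hy
        simp only [Pi.zero_apply]
        positivity

lemma summable_mittagLeffler₂ {α β : ℝ} (hα : 0 < α) (hβ : 0 < β) (z : ℝ) :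
    Summable fun k : ℕ => z ^ k / Real.Gamma (α * (k : ℝ) + β) := by
  set M : ℝ := (2 * |z| + 1) ^ (1 / α) with hM
  have hM0 : 0 < M := by positivity
  have hMα : M ^ α = 2 * |z| + 1 := by
    rw [hM, ← Real.rpow_mul (by positivity), one_div_mul_cancel hα.ne', Real.rpow_one]
  obtain ⟨N, hN⟩ := exists_nat_ge (1 / α)
  have hgeo : Summable fun k : ℕ => Real.exp (M + 1) * M ^ (1 - β) * (1 / 2 : ℝ) ^ k :=
    (summable_geometric_of_lt_one (by norm_num) (by norm_num)).mul_left _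
  refine hgeo.of_norm_bounded_eventually_nat ?_
  filter_upwards [Filter.eventually_ge_atTop N] with k hk
  have hαk : 1 ≤ α * (k : ℝ) + β := by
    have : 1 / α ≤ (k : ℝ) := hN.trans (by exact_mod_cast hk)
    rw [div_le_iff₀ hα] at this
    linarith
  have hG := rpow_sub_one_mul_exp_le_Gamma hM0 hαk
  have hpow : M ^ (α * (k : ℝ) + β - 1) = (2 * |z| + 1) ^ k * M ^ (β - 1) := by
    rw [add_sub_assoc, Real.rpow_add hM0, Real.rpow_mul hM0.le, hMα, Real.rpow_natCast]
  have hlow : 0 < M ^ (α * (k : ℝ) + β - 1) * Real.exp (-(M + 1)) := by positivity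
  have hGpos := hlow.trans_le hG
  rw [norm_div, norm_pow, Real.norm_eq_abs, Real.norm_eq_abs, abs_of_pos hGpos,
    div_le_iff₀ hGpos]
  have hz : |z| ^ k ≤ (1 / 2 : ℝ) ^ k * (2 * |z| + 1) ^ k := by
    rw [← mul_pow]
    exact pow_le_pow_left₀ (abs_nonneg z) (by linarith) k
  calc |z| ^ k ≤ (1 / 2 : ℝ) ^ k * (2 * |z| + 1) ^ k := hz
    _ = Real.exp (M + 1) * M ^ (1 - β) * (1 / 2 : ℝ) ^ k *
          (M ^ (α * (k : ℝ) + β - 1) * Real.exp (-(M + 1))) := by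
        have h1 : M ^ (1 - β) * M ^ (β - 1) = 1 := by
          rw [← Real.rpow_add hM0]; simp
        have h2 : Real.exp (M + 1) * Real.exp (-(M + 1)) = 1 := by
          rw [← Real.exp_add]; simp
        rw [hpow]
        linear_combination (-(1 / 2 : ℝ) ^ k * (2 * |z| + 1) ^ k) *
          (Real.exp (M + 1) * Real.exp (-(M + 1)) * h1 + h2)
    _ ≤ _ := by gcongr

lemma continuous_mittagLeffler₂ {α β : ℝ} (hα : 0 < α) (hβ : 0 < β) :
    Continuous (mittagLeffler₂ α β) := by
  rw [continuous_iff_continuousAt]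
  intro z
  have hU : Metric.closedBall (0 : ℝ) (|z| + 1) ∈ nhds z :=
    Metric.closedBall_mem_nhds_of_mem (by simp)
  refine ContinuousOn.continuousAt ?_ hU
  refine continuousOn_tsum (fun k => by fun_prop)
    (summable_mittagLeffler₂ hα hβ (|z| + 1)) fun k y hy => ?_
  have hy' : |y| ≤ |z| + 1 := by simpa using hy
  have hΓ : 0 < Real.Gamma (α * (k : ℝ) + β) := Real.Gamma_pos_of_pos (by positivity)
  rw [norm_div, norm_pow, Real.norm_eq_abs, Real.norm_eq_abs, abs_of_pos hΓ]
  gcongr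

lemma mittagLeffler₂_zero (α β : ℝ) : mittagLeffler₂ α β 0 = 1 / Real.Gamma β := by
  rw [mittagLeffler₂, tsum_eq_single 0]
  · simp
  · intro k hk
    simp [hk]

lemma integral_sub_rpow_mul_rpow {a b t : ℝ} (ha : 0 < a) (hb : 0 < b) (ht : 0 < t) :
    ∫ s in (0 : ℝ)..t, (t - s) ^ (a - 1) * s ^ (b - 1) =
      t ^ (a + b - 1) * (Real.Gamma a * Real.Gamma b / Real.Gamma (a + b)) := by
  have h := Complex.betaIntegral_scaled (b : ℂ) (a : ℂ) ht
  have hB := Complex.Gamma_mul_Gamma_eq_betaIntegral (s := (b : ℂ)) (t := (a : ℂ))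
    (by simpa using hb) (by simpa using ha)
  have hΓ : Real.Gamma (a + b) ≠ 0 := (Real.Gamma_pos_of_pos (by positivity)).ne'
  have hcongr : ∫ s in (0 : ℝ)..t, (s : ℂ) ^ ((b : ℂ) - 1) * ((t : ℂ) - s) ^ ((a : ℂ) - 1) =
      ((∫ s in (0 : ℝ)..t, (t - s) ^ (a - 1) * s ^ (b - 1) : ℝ) : ℂ) := by
    rw [← intervalIntegral.integral_ofReal]
    refine intervalIntegral.integral_congr fun s hs => ?_
    rw [uIcc_of_le ht.le] at hs
    push_cast [Complex.ofReal_cpow hs.1, Complex.ofReal_cpow (sub_nonneg.2 hs.2)]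
    ring
  rw [hcongr] at h
  have hΓ' : Complex.Gamma ((b : ℂ) + a) ≠ 0 := by
    rw [← Complex.ofReal_add, Complex.Gamma_ofReal, add_comm b a]
    exact_mod_cast hΓ
  have hB' : Complex.betaIntegral (b : ℂ) a =
      ((Real.Gamma a * Real.Gamma b / Real.Gamma (a + b) : ℝ) : ℂ) := by
    rw [eq_comm, ← mul_right_inj' hΓ', ← hB, ← Complex.ofReal_add, Complex.Gamma_ofReal,
      Complex.Gamma_ofReal, Complex.Gamma_ofReal, ← Complex.ofReal_mul, ← Complex.ofReal_mul,
      add_comm b a]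
    congr 1
    field_simp
  rw [hB'] at h
  have ht' : (t : ℂ) ^ ((b : ℂ) + a - 1) = ((t ^ (a + b - 1) : ℝ) : ℂ) := by
    rw [Complex.ofReal_cpow ht.le]
    push_cast
    ring_nf
  rw [ht'] at h
  exact_mod_cast h

lemma intervalIntegrable_sub_rpow_mul_rpow {a b t : ℝ} (ha : 0 < a) (hb : 0 < b) (ht : 0 < t) :
    IntervalIntegrable (fun s => (t - s) ^ (a - 1) * s ^ (b - 1)) volume 0 t := by
  refine intervalIntegral.intervalIntegrable_of_integral_ne_zero ?_
  rw [integral_sub_rpow_mul_rpow ha hb ht]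
  have := Real.Gamma_pos_of_pos ha
  have := Real.Gamma_pos_of_pos hb
  have := Real.Gamma_pos_of_pos (add_pos ha hb)
  positivity

/-- The function `t ↦ t^{β-1} E_{α,β}(a t^α)` solves a Volterra equation with Abel kernel. -/
lemma mittagLeffler₂_volterra {α β t : ℝ} (hα : 0 < α) (hβ : 0 < β) (ht : 0 < t) (a : ℝ) :
    t ^ (β - 1) * mittagLeffler₂ α β (a * t ^ α) = t ^ (β - 1) / Real.Gamma β +
      a / Real.Gamma α * ∫ s in (0 : ℝ)..t,
        (t - s) ^ (α - 1) * (s ^ (β - 1) * mittagLeffler₂ α β (a * s ^ α)) := by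
  have hΓα : 0 < Real.Gamma α := Real.Gamma_pos_of_pos hα
  have hΓ : ∀ k : ℕ, 0 < Real.Gamma (α * (k : ℝ) + β) := fun k =>
    Real.Gamma_pos_of_pos (by positivity)
  let F : ℝ → ℕ → ℝ → ℝ := fun c k s =>
    (t - s) ^ (α - 1) * (s ^ (β - 1) * ((c * s ^ α) ^ k / Real.Gamma (α * (k : ℝ) + β)))
  have hFeq : ∀ (c : ℝ) (k : ℕ), ∀ s ∈ Ioc 0 t,
      F c k s = c ^ k / Real.Gamma (α * (k : ℝ) + β) *
        ((t - s) ^ (α - 1) * s ^ (α * (k : ℝ) + β - 1)) := by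
    intro c k s hs
    have : s ^ (α * (k : ℝ) + β - 1) = (s ^ α) ^ k * s ^ (β - 1) := by
      rw [add_sub_assoc, Real.rpow_add hs.1, Real.rpow_mul hs.1.le, Real.rpow_natCast]
    simp only [F]
    rw [this, mul_pow]
    ring
  have hFint : ∀ c k, IntegrableOn (F c k) (Ioc 0 t) := by
    intro c k
    have h := (intervalIntegrable_sub_rpow_mul_rpow hα
      (show 0 < α * (k : ℝ) + β by positivity) ht).const_mul
        (c ^ k / Real.Gamma (α * (k : ℝ) + β))
    rw [intervalIntegrable_iff_integrableOn_Ioc_of_le ht.le] at h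
    exact h.congr_fun (fun s hs => (hFeq c k s hs).symm) measurableSet_Ioc
  have hFval : ∀ c k, ∫ s in Ioc 0 t, F c k s = Real.Gamma α * t ^ (β - 1) * t ^ α *
      ((c * t ^ α) ^ k / Real.Gamma (α * ((k + 1 : ℕ) : ℝ) + β)) := by
    intro c k
    have h := integral_sub_rpow_mul_rpow hα (show 0 < α * (k : ℝ) + β by positivity) ht
    rw [intervalIntegral.integral_of_le ht.le] at h
    rw [setIntegral_congr_fun measurableSet_Ioc (hFeq c k), MeasureTheory.integral_const_mul, h]
    have e : α + (α * (k : ℝ) + β) = α * ((k + 1 : ℕ) : ℝ) + β := by push_cast; ring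
    have e2 : t ^ (α + (α * (k : ℝ) + β) - 1) = t ^ α * (t ^ α) ^ k * t ^ (β - 1) := by
      rw [show α + (α * (k : ℝ) + β) - 1 = α + α * (k : ℝ) + (β - 1) by ring,
        Real.rpow_add ht, Real.rpow_add ht, Real.rpow_mul ht.le, Real.rpow_natCast]
    rw [e2, e, mul_pow]
    have := (hΓ k).ne'
    have := (hΓ (k + 1)).ne'
    field_simp
  have hnorm : ∀ k, ∫ s in Ioc 0 t, ‖F a k s‖ = ∫ s in Ioc 0 t, F |a| k s := by
    intro k
    refine setIntegral_congr_fun measurableSet_Ioc fun s hs => ?_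
    have h1 : 0 ≤ (t - s) ^ (α - 1) := Real.rpow_nonneg (sub_nonneg.2 hs.2) _
    have h2 : 0 ≤ s ^ (β - 1) := Real.rpow_nonneg hs.1.le _
    have h3 : 0 ≤ s ^ α := Real.rpow_nonneg hs.1.le _
    simp only [F, norm_mul, norm_div, norm_pow, Real.norm_eq_abs, abs_of_nonneg h1,
      abs_of_nonneg h2, abs_of_nonneg h3, abs_of_pos (hΓ k)]
  have hsumm : ∀ c : ℝ, Summable fun k : ℕ => Real.Gamma α * t ^ (β - 1) * t ^ α *
      ((c * t ^ α) ^ k / Real.Gamma (α * ((k + 1 : ℕ) : ℝ) + β)) := by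
    intro c
    refine Summable.mul_left _ ?_
    refine (summable_mittagLeffler₂ hα (add_pos hα hβ) (c * t ^ α)).congr fun k => ?_
    congr 2
    push_cast
    ring
  have hmain : ∫ s in (0 : ℝ)..t,
        (t - s) ^ (α - 1) * (s ^ (β - 1) * mittagLeffler₂ α β (a * s ^ α)) =
      ∑' k : ℕ, Real.Gamma α * t ^ (β - 1) * t ^ α *
        ((a * t ^ α) ^ k / Real.Gamma (α * ((k + 1 : ℕ) : ℝ) + β)) := by
    have h := integral_tsum_of_summable_integral_norm (hFint a)
      (by simp only [hnorm, hFval]; exact hsumm |a|)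
    simp only [hFval] at h
    rw [h, intervalIntegral.integral_of_le ht.le]
    simp only [F, mittagLeffler₂, tsum_mul_left]
  rw [hmain, mittagLeffler₂, (summable_mittagLeffler₂ hα hβ (a * t ^ α)).tsum_eq_zero_add,
    mul_add, tsum_mul_left]
  have : ∑' k : ℕ, (a * t ^ α) ^ (k + 1) / Real.Gamma (α * ((k + 1 : ℕ) : ℝ) + β) =
      a * t ^ α * ∑' k : ℕ, (a * t ^ α) ^ k / Real.Gamma (α * ((k + 1 : ℕ) : ℝ) + β) := by
    rw [← tsum_mul_left]
    refine tsum_congr fun k => ?_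
    rw [pow_succ]
    ring
  rw [this]
  simp only [pow_zero, Nat.cast_zero, mul_zero, zero_add]
  field_simp

lemma exists_first_nonpos {y : ℝ → ℝ} {T : ℝ} (hy : ContinuousOn y (Icc 0 T)) (hT : 0 ≤ T)
    (hyT : y T ≤ 0) :
    ∃ t, (t ∈ Icc 0 T ∧ y t ≤ 0) ∧ ∀ s ∈ Ico 0 t, 0 < y s := by
  have hcl : IsClosed (Icc 0 T ∩ y ⁻¹' Iic 0) := hy.preimage_isClosed_of_isClosed isClosed_Icc
    isClosed_Iic
  have hK : IsCompact (Icc 0 T ∩ y ⁻¹' Iic 0) :=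
    isCompact_Icc.of_isClosed_subset hcl inter_subset_left
  obtain ⟨t, ht, hmin⟩ := hK.exists_isLeast ⟨T, ⟨hT, le_rfl⟩, hyT⟩
  refine ⟨t, ht, fun s hs => ?_⟩
  by_contra! h
  exact absurd (hmin ⟨⟨hs.1, hs.2.le.trans ht.1.2⟩, h⟩) (not_le.2 hs.2)

lemma intervalIntegrable_abel_mul {α β t : ℝ} (hα : 0 < α) (hβ : 0 < β) (ht : 0 < t)
    {y : ℝ → ℝ} (hy : ContinuousOn y (Icc 0 t)) :
    IntervalIntegrable (fun s => (t - s) ^ (α - 1) * (s ^ (β - 1) * y s)) volume 0 t := by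
  have h := (intervalIntegrable_sub_rpow_mul_rpow hα hβ ht).mul_continuousOn
    (g := y) (by rwa [uIcc_of_le ht.le])
  simpa only [mul_assoc] using h

lemma sub_rpow_sub_one_le {α s τ t : ℝ} (hα1 : α ≤ 1) (hs : 0 ≤ s) (hsτ : s < τ) (hτt : τ ≤ t) :
    (t - s) ^ (α - 1) ≤ (t / τ) ^ (α - 1) * (τ - s) ^ (α - 1) := by
  have hτ : 0 < τ := hs.trans_lt hsτ
  have ht : 0 < t := hτ.trans_le hτt
  rw [← Real.mul_rpow (by positivity) (by linarith)]
  refine Real.rpow_le_rpow_of_nonpos (mul_pos (by positivity) (by linarith)) ?_ (by linarith)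
  rw [div_mul_eq_mul_div, div_le_iff₀ hτ]
  nlinarith

/-- Solutions of the linear Volterra equation with a negative multiple of the Abel kernel and
forcing term `t^{β-1}/Γ(β)`, `α ≤ β`, cannot reach zero. -/
lemma volterra_no_first_zero {α β lam t : ℝ} (hα : 0 < α) (hα1 : α ≤ 1) (hαβ : α ≤ β)
    (hlam : 0 ≤ lam) (ht : 0 < t) {y : ℝ → ℝ} (hy : ContinuousOn y (Icc 0 t))
    (hpos : ∀ s ∈ Ico 0 t, 0 < y s)
    (heq : ∀ s ∈ Ioc 0 t, s ^ (β - 1) * y s = s ^ (β - 1) / Real.Gamma β -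
      lam * ∫ r in (0 : ℝ)..s, (s - r) ^ (α - 1) * (r ^ (β - 1) * y r)) :
    0 < y t := by
  by_contra! hyt
  have hβ : 0 < β := hα.trans_le hαβ
  have hΓβ : 0 < Real.Gamma β := Real.Gamma_pos_of_pos hβ
  set x : ℝ → ℝ := fun s => s ^ (β - 1) * y s with hx
  have hxpos : ∀ s ∈ Ioo 0 t, 0 < x s := fun s hs =>
    mul_pos (Real.rpow_pos_of_pos hs.1 _) (hpos s ⟨hs.1.le, hs.2⟩)
  have hxt : x t ≤ 0 := mul_nonpos_of_nonneg_of_nonpos (Real.rpow_nonneg ht.le _) hyt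
  obtain ⟨τ₀, hτ₀, hsmall⟩ : ∃ τ₀ ∈ Ioo (t / 2) t, lam * ((t - τ₀) ^ α / α) < 1 / 2 := by
    have hcont : Filter.Tendsto (fun τ : ℝ => lam * ((t - τ) ^ α / α)) (nhds t) (nhds 0) := by
      have : Continuous fun τ : ℝ => lam * ((t - τ) ^ α / α) := by
        have := (Real.continuous_rpow_const hα.le).comp (continuous_const.sub continuous_id :
          Continuous fun τ : ℝ => t - τ)
        exact (this.div_const α).const_mul lam
      have h := this.tendsto t
      simpa [Real.zero_rpow hα.ne'] using h
    have h1 : ∀ᶠ τ in nhdsWithin t (Iio t), lam * ((t - τ) ^ α / α) < 1 / 2 :=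
      (hcont.mono_left nhdsWithin_le_nhds).eventually (gt_mem_nhds (by norm_num))
    have h2 : ∀ᶠ τ in nhdsWithin t (Iio t), τ ∈ Ioo (t / 2) t :=
      Ioo_mem_nhdsLT (by linarith)
    obtain ⟨τ, h, h'⟩ := (h2.and h1).exists
    exact ⟨τ, h, h'⟩
  have hτ₀0 : 0 < τ₀ := by linarith [hτ₀.1]
  have hxc : ContinuousOn x (Icc τ₀ t) := by
    refine ContinuousOn.mul (fun s hs => ?_) (hy.mono (Icc_subset_Icc_left hτ₀0.le))
    exact (Real.continuousAt_rpow_const s _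
      (Or.inl (hτ₀0.trans_le hs.1).ne')).continuousWithinAt
  obtain ⟨τ, hτ, hmax⟩ := isCompact_Icc.exists_isMaxOn (nonempty_Icc.2 hτ₀.2.le) hxc
  have hxτ : 0 < x τ := (hxpos τ₀ ⟨hτ₀0, hτ₀.2⟩).trans_le (hmax (left_mem_Icc.2 hτ₀.2.le))
  have hτt : τ < t := by
    rcases hτ.2.lt_or_eq with h | h
    · exact h
    · rw [h] at hxτ; linarith
  have hτ0 : 0 < τ := hτ₀0.trans_le hτ.1
  set ρ : ℝ := (t / τ) ^ (α - 1) with hρ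
  have hone : 1 ≤ t / τ := by rw [le_div_iff₀ hτ0]; linarith
  have htwo : t / τ ≤ 2 := by rw [div_le_iff₀ hτ0]; linarith [hτ₀.1, hτ.1]
  have hρhalf : 1 / 2 ≤ ρ := by
    have h1 : (2 : ℝ) ^ (-1 : ℝ) ≤ 2 ^ (α - 1) :=
      Real.rpow_le_rpow_of_exponent_le (by norm_num) (by linarith)
    have h2 : (2 : ℝ) ^ (α - 1) ≤ ρ :=
      Real.rpow_le_rpow_of_nonpos (by linarith) htwo (by linarith)
    rw [Real.rpow_neg_one] at h1
    linarith
  have hintt : IntervalIntegrable (fun r => (t - r) ^ (α - 1) * x r) volume 0 t :=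
    intervalIntegrable_abel_mul hα hβ ht hy
  have hintτ : IntervalIntegrable (fun r => (τ - r) ^ (α - 1) * x r) volume 0 τ :=
    intervalIntegrable_abel_mul hα hβ hτ0 (hy.mono (Icc_subset_Icc_right hτt.le))
  have hint1 : IntervalIntegrable (fun r => (t - r) ^ (α - 1) * x r) volume 0 τ :=
    hintt.mono_set (by rw [uIcc_of_le hτ0.le, uIcc_of_le ht.le]; exact Icc_subset_Icc_right hτt.le)
  have hint2 : IntervalIntegrable (fun r => (t - r) ^ (α - 1) * x r) volume τ t :=
    hintt.mono_set (by rw [uIcc_of_le hτt.le, uIcc_of_le ht.le]; exact Icc_subset_Icc_left hτ0.le)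
  have hI1 : ∫ r in (0 : ℝ)..τ, (t - r) ^ (α - 1) * x r ≤
      ρ * ∫ r in (0 : ℝ)..τ, (τ - r) ^ (α - 1) * x r := by
    rw [← intervalIntegral.integral_const_mul]
    refine intervalIntegral.integral_mono_on_of_le_Ioo hτ0.le hint1 (hintτ.const_mul ρ) ?_
    intro r hr
    rw [← mul_assoc ρ]
    exact mul_le_mul_of_nonneg_right (sub_rpow_sub_one_le hα1 hr.1.le hr.2 hτt.le)
      (hxpos r ⟨hr.1, hr.2.trans hτt⟩).le
  have hker : ∫ r in τ..t, (t - r) ^ (α - 1) = (t - τ) ^ α / α := by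
    rw [intervalIntegral.integral_comp_sub_left (fun r => r ^ (α - 1)) t, sub_self,
      integral_rpow (Or.inl (by linarith))]
    simp [Real.zero_rpow hα.ne']
  have hkerint : IntervalIntegrable (fun r => (t - r) ^ (α - 1)) volume τ t := by
    have := (intervalIntegral.intervalIntegrable_rpow' (a := t - τ) (b := 0)
      (show -1 < α - 1 by linarith)).comp_sub_left t
    simpa using this
  have hI2 : ∫ r in τ..t, (t - r) ^ (α - 1) * x r ≤ (t - τ) ^ α / α * x τ := by
    rw [← hker, ← intervalIntegral.integral_mul_const]
    refine intervalIntegral.integral_mono_on hτt.le hint2 (hkerint.mul_const _) ?_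
    intro r hr
    exact mul_le_mul_of_nonneg_left (hmax ⟨hτ.1.trans hr.1, hr.2⟩)
      (Real.rpow_nonneg (sub_nonneg.2 hr.2) _)
  have hsplit := intervalIntegral.integral_add_adjacent_intervals hint1 hint2
  have heqt : x t = t ^ (β - 1) / Real.Gamma β -
      lam * ∫ r in (0 : ℝ)..t, (t - r) ^ (α - 1) * x r := heq t ⟨ht, le_rfl⟩
  have heqτ : x τ = τ ^ (β - 1) / Real.Gamma β -
      lam * ∫ r in (0 : ℝ)..τ, (τ - r) ^ (α - 1) * x r := heq τ ⟨hτ0, hτt.le⟩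
  have hF : ρ * (τ ^ (β - 1) / Real.Gamma β) ≤ t ^ (β - 1) / Real.Gamma β := by
    rw [← mul_div_assoc]
    refine div_le_div_of_nonneg_right ?_ hΓβ.le
    calc ρ * τ ^ (β - 1) ≤ (t / τ) ^ (β - 1) * τ ^ (β - 1) := by
          refine mul_le_mul_of_nonneg_right ?_ (Real.rpow_nonneg hτ0.le _)
          exact Real.rpow_le_rpow_of_exponent_le hone (by linarith)
      _ = t ^ (β - 1) := by
          rw [← Real.mul_rpow (by positivity) hτ0.le, div_mul_cancel₀ _ hτ0.ne']
  have hδ : lam * ((t - τ) ^ α / α) < 1 / 2 := by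
    refine lt_of_le_of_lt ?_ hsmall
    refine mul_le_mul_of_nonneg_left ?_ hlam
    refine div_le_div_of_nonneg_right ?_ hα.le
    exact Real.rpow_le_rpow (by linarith) (by linarith [hτ.1]) hα.le
  have h1 := mul_le_mul_of_nonneg_left hI1 hlam
  have h2 := mul_le_mul_of_nonneg_left hI2 hlam
  rw [← hsplit] at heqt
  have h3 : lam * ((t - τ) ^ α / α) * x τ < ρ * x τ :=
    mul_lt_mul_of_pos_right (hδ.trans_le hρhalf) hxτ
  have h4 : ρ * x τ = ρ * (τ ^ (β - 1) / Real.Gamma β) -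
      lam * (ρ * ∫ r in (0 : ℝ)..τ, (τ - r) ^ (α - 1) * x r) := by
    conv_lhs => rw [heqτ]
    ring
  linarith

lemma mittagLeffler₂_pos {α β : ℝ} (hα : 0 < α) (hα1 : α ≤ 1) (hαβ : α ≤ β) (z : ℝ) :
    0 < mittagLeffler₂ α β z := by
  have hβ : 0 < β := hα.trans_le hαβ
  have hcont := continuous_mittagLeffler₂ hα hβ
  have hzero : 0 < mittagLeffler₂ α β 0 := by
    rw [mittagLeffler₂_zero]
    exact one_div_pos.2 (Real.Gamma_pos_of_pos hβ)
  rcases le_or_gt 0 z with hz | hz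
  · refine (summable_mittagLeffler₂ hα hβ z).tsum_pos (fun k => ?_) 0 ?_
    · have : 0 < Real.Gamma (α * (k : ℝ) + β) := Real.Gamma_pos_of_pos (by positivity)
      positivity
    · simpa using Real.Gamma_pos_of_pos hβ
  set y : ℝ → ℝ := fun t => mittagLeffler₂ α β (-1 * t ^ α) with hy
  have hyc : Continuous y := hcont.comp ((Real.continuous_rpow_const hα.le).const_mul (-1))
  have hy0 : 0 < y 0 := by simpa [hy, Real.zero_rpow hα.ne'] using hzero
  suffices h : ∀ t, 0 ≤ t → 0 < y t by
    have := h ((-z) ^ (1 / α)) (Real.rpow_nonneg (by linarith) _)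
    simpa [hy, ← Real.rpow_mul (show 0 ≤ -z by linarith), hα.ne'] using this
  by_contra! hcon
  obtain ⟨t', ht', hyt'⟩ := hcon
  obtain ⟨t, ⟨ht, hyt⟩, hmin⟩ := exists_first_nonpos hyc.continuousOn ht' hyt'
  have ht0 : 0 < t := ht.1.lt_of_ne fun h => by rw [← h] at hyt; linarith
  have hΓ := Real.Gamma_pos_of_pos hα
  refine absurd (volterra_no_first_zero hα hα1 hαβ (lam := 1 / Real.Gamma α) (by positivity) ht0
    hyc.continuousOn hmin fun s hs => ?_) (not_lt.2 hyt)
  rw [hy, mittagLeffler₂_volterra hα hβ hs.1 (-1)]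
  ring

open scoped Convolution in
lemma indicator_convolution_indicator {f g : ℝ → ℝ} {t T : ℝ} (ht : 0 ≤ t) (htT : t ≤ T) :
    ((Ioo 0 T).indicator f ⋆[ContinuousLinearMap.mul ℝ ℝ] (Ioo 0 T).indicator g) t =
      ∫ s in (0 : ℝ)..t, f (t - s) * g s := by
  rw [convolution_mul_swap, intervalIntegral.integral_of_le ht, integral_Ioc_eq_integral_Ioo,
    ← MeasureTheory.integral_indicator measurableSet_Ioo]
  congr 1
  ext s
  by_cases hs : s ∈ Ioo 0 t
  · have h1 : t - s ∈ Ioo 0 T := ⟨by linarith [hs.2], by linarith [hs.1]⟩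
    have h2 : s ∈ Ioo 0 T := ⟨hs.1, hs.2.trans_le htT⟩
    simp [hs, h1, h2]
  · rw [indicator_of_notMem hs]
    by_cases h2 : s ∈ Ioo 0 T
    · have h1 : t - s ∉ Ioo 0 T := fun h => hs ⟨h2.1, by linarith [h.1]⟩
      simp [h1]
    · simp [h2]

/-- Associativity of the finite convolution on `[0,T]`. -/
lemma volterra_convolution_assoc {k r q : ℝ → ℝ} {T : ℝ} (hT : 0 ≤ T)
    (hk : IntervalIntegrable k volume 0 T) (hr : IntervalIntegrable r volume 0 T)
    (hq : ContinuousOn q (Icc 0 T)) :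
    ∫ s in (0 : ℝ)..T, r (T - s) * ∫ u in (0 : ℝ)..s, k (s - u) * q u =
      ∫ s in (0 : ℝ)..T, (∫ u in (0 : ℝ)..(T - s), r (T - s - u) * k u) * q s := by
  let L := ContinuousLinearMap.mul ℝ ℝ
  have trunc : ∀ {f : ℝ → ℝ}, IntervalIntegrable f volume 0 T →
      Integrable ((Ioo 0 T).indicator f) := by
    intro f hf
    rw [intervalIntegrable_iff_integrableOn_Ioo_of_le hT] at hf
    exact hf.integrable_indicator measurableSet_Ioo
  have hqi : IntervalIntegrable q volume 0 T :=
    ContinuousOn.intervalIntegrable (by rwa [uIcc_of_le hT])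
  set R := (Ioo 0 T).indicator r with hR
  set K := (Ioo 0 T).indicator k with hK
  set Q := (Ioo 0 T).indicator q with hQ
  obtain ⟨C, hC⟩ := isCompact_Icc.exists_bound_of_continuousOn hq
  have hQb : ∀ s, ‖Q s‖ ≤ max C 0 := by
    intro s
    by_cases hs : s ∈ Ioo 0 T
    · rw [hQ, indicator_of_mem hs]
      exact (hC s (Ioo_subset_Icc_self hs)).trans (le_max_left _ _)
    · rw [hQ, indicator_of_notMem hs]
      simp
  have hRi := trunc hr
  have hKi := trunc hk
  have hQi := trunc hqi
  have hKQ : Integrable (convolution (fun x => ‖K x‖) (fun x => ‖Q x‖) L volume) :=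
    hKi.norm.integrable_convolution L hQi.norm
  have hKQb : ∀ x, ‖convolution (fun x => ‖K x‖) (fun x => ‖Q x‖) L volume x‖ ≤
      ∫ s, ‖K s‖ * max C 0 := by
    intro x
    refine norm_integral_le_of_norm_le (hKi.norm.mul_const _) (Filter.Eventually.of_forall ?_)
    intro s
    simp only [L, ContinuousLinearMap.mul_apply', norm_mul, norm_norm]
    exact mul_le_mul_of_nonneg_left (hQb _) (norm_nonneg _)
  have hassoc := convolution_assoc L L L L (fun x y z => mul_assoc x y z) (x₀ := T)
    hRi.aestronglyMeasurable hKi.aestronglyMeasurable hQi.aestronglyMeasurable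
    (hRi.ae_convolution_exists L hKi) (hKi.norm.ae_convolution_exists L hQi.norm)
    (hRi.norm.mul_bdd (c := ∫ s, ‖K s‖ * max C 0)
      (hKQ.aestronglyMeasurable.comp_measurePreserving
        (Measure.measurePreserving_sub_left volume T))
      (Filter.Eventually.of_forall fun s => hKQb _))
  have hleft : convolution R (convolution K Q L volume) L volume T =
      ∫ s in (0 : ℝ)..T, r (T - s) * ∫ u in (0 : ℝ)..s, k (s - u) * q u := by
    rw [convolution_mul_swap, intervalIntegral.integral_of_le hT, integral_Ioc_eq_integral_Ioo,
      ← MeasureTheory.integral_indicator measurableSet_Ioo]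
    congr 1
    ext s
    by_cases hs : s ∈ Ioo 0 T
    · have h1 : T - s ∈ Ioo 0 T := ⟨by linarith [hs.2], by linarith [hs.1]⟩
      rw [indicator_of_mem hs, hR, indicator_of_mem h1, hK, hQ,
        indicator_convolution_indicator hs.1.le hs.2.le]
    · have h1 : T - s ∉ Ioo 0 T := fun h => hs ⟨by linarith [h.2], by linarith [h.1]⟩
      rw [indicator_of_notMem hs, hR, indicator_of_notMem h1, zero_mul]
  have hright : convolution (convolution R K L volume) Q L volume T =
      ∫ s in (0 : ℝ)..T, (∫ u in (0 : ℝ)..(T - s), r (T - s - u) * k u) * q s := by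
    rw [convolution_mul_swap, intervalIntegral.integral_of_le hT, integral_Ioc_eq_integral_Ioo,
      ← MeasureTheory.integral_indicator measurableSet_Ioo]
    congr 1
    ext s
    by_cases hs : s ∈ Ioo 0 T
    · rw [indicator_of_mem hs, hQ, indicator_of_mem hs, hR, hK,
        indicator_convolution_indicator (by linarith [hs.2]) (by linarith [hs.1])]
    · rw [indicator_of_notMem hs, hQ, indicator_of_notMem hs, mul_zero]
  rw [← hleft, ← hright, hassoc]

/-- Positivity of solutions of a linear fractional differential inequality with zero initial
value. -/
lemma nonneg_of_abel_volterra {α T a : ℝ} (hα : 0 < α) (hα1 : α ≤ 1) (hT : 0 < T)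
    {q w : ℝ → ℝ} (hq : ContinuousOn q (Icc 0 T)) (hw : ContinuousOn w (Icc 0 T))
    (heq : ∀ s ∈ Icc 0 T,
      w s = 1 / Real.Gamma α * ∫ r in (0 : ℝ)..s, (s - r) ^ (α - 1) * q r)
    (hle : ∀ s ∈ Ioo 0 T, a * w s ≤ q s) : 0 ≤ w T := by
  set R : ℝ → ℝ := fun s => s ^ (α - 1) * mittagLeffler₂ α α (a * s ^ α) with hR
  have hkint : IntervalIntegrable (fun s : ℝ => s ^ (α - 1)) volume 0 T :=
    intervalIntegral.intervalIntegrable_rpow' (by linarith)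
  have hyc : Continuous fun s : ℝ => mittagLeffler₂ α α (a * s ^ α) :=
    (continuous_mittagLeffler₂ hα hα).comp ((Real.continuous_rpow_const hα.le).const_mul a)
  have hRint : IntervalIntegrable R volume 0 T := hkint.mul_continuousOn hyc.continuousOn
  have hflip : ∀ {f : ℝ → ℝ}, IntervalIntegrable f volume 0 T →
      IntervalIntegrable (fun s => f (T - s)) volume 0 T := by
    intro f hf
    simpa using (hf.comp_sub_left T).symm
  have hu : uIcc 0 T = Icc 0 T := uIcc_of_le hT.le
  have hRq : IntervalIntegrable (fun s => R (T - s) * q s) volume 0 T :=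
    (hflip hRint).mul_continuousOn (by rwa [hu])
  have hRw : IntervalIntegrable (fun s => R (T - s) * w s) volume 0 T :=
    (hflip hRint).mul_continuousOn (by rwa [hu])
  have hkq : IntervalIntegrable (fun s => (T - s) ^ (α - 1) * q s) volume 0 T :=
    (hflip hkint).mul_continuousOn (by rwa [hu])
  have hassoc := volterra_convolution_assoc hT.le hkint hRint hq
  have hlhs : ∫ s in (0 : ℝ)..T, R (T - s) * w s = 1 / Real.Gamma α *
      ∫ s in (0 : ℝ)..T, R (T - s) * ∫ r in (0 : ℝ)..s, (s - r) ^ (α - 1) * q r := by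
    rw [← intervalIntegral.integral_const_mul]
    refine intervalIntegral.integral_congr fun s hs => ?_
    rw [hu] at hs
    simp only [heq s hs]
    ring
  have hrhs : a / Real.Gamma α * ∫ s in (0 : ℝ)..T,
        (∫ u in (0 : ℝ)..(T - s), R (T - s - u) * u ^ (α - 1)) * q s =
      ∫ s in (0 : ℝ)..T,
        (R (T - s) * q s - 1 / Real.Gamma α * ((T - s) ^ (α - 1) * q s)) := by
    rw [← intervalIntegral.integral_const_mul, intervalIntegral.integral_of_le hT.le,
      intervalIntegral.integral_of_le hT.le, integral_Ioc_eq_integral_Ioo,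
      integral_Ioc_eq_integral_Ioo]
    refine setIntegral_congr_fun measurableSet_Ioo fun s hs => ?_
    have hTs : 0 < T - s := by linarith [hs.2]
    have hsub := intervalIntegral.integral_comp_sub_left (a := 0) (b := T - s)
      (fun u => R (T - s - u) * u ^ (α - 1)) (T - s)
    simp only [sub_sub_cancel, sub_self, sub_zero] at hsub
    have hv : R (T - s) = _ := mittagLeffler₂_volterra hα hα hTs a
    have hcomm : ∫ u in (0 : ℝ)..(T - s), R u * (T - s - u) ^ (α - 1) =
        ∫ u in (0 : ℝ)..(T - s),
          (T - s - u) ^ (α - 1) * (u ^ (α - 1) * mittagLeffler₂ α α (a * u ^ α)) :=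
      intervalIntegral.integral_congr fun u _ => mul_comm _ _
    rw [← hsub, hcomm, hv]
    ring
  have hrep : w T = ∫ s in (0 : ℝ)..T, R (T - s) * (q s - a * w s) := by
    have h1 : ∫ s in (0 : ℝ)..T, R (T - s) * (q s - a * w s) =
        (∫ s in (0 : ℝ)..T, R (T - s) * q s) - a * ∫ s in (0 : ℝ)..T, R (T - s) * w s := by
      rw [← intervalIntegral.integral_const_mul,
        ← intervalIntegral.integral_sub hRq (hRw.const_mul a)]
      refine intervalIntegral.integral_congr fun s _ => ?_
      ring
    rw [intervalIntegral.integral_sub hRq (hkq.const_mul _),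
      intervalIntegral.integral_const_mul, ← heq T ⟨hT.le, le_rfl⟩, ← hassoc] at hrhs
    rw [h1, hlhs]
    linear_combination hrhs
  rw [hrep, intervalIntegral.integral_of_le hT.le, integral_Ioc_eq_integral_Ioo]
  refine setIntegral_nonneg measurableSet_Ioo fun s hs => mul_nonneg ?_ ?_
  · exact mul_nonneg (Real.rpow_nonneg (by linarith [hs.2]) _)
      (mittagLeffler₂_pos hα hα1 le_rfl _).le
  · linarith [hle s hs]

lemma mittagLeffler₂_one_volterra {α s : ℝ} (hα : 0 < α) (hs : 0 ≤ s) (a : ℝ) :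
    mittagLeffler₂ α 1 (a * s ^ α) = 1 + 1 / Real.Gamma α *
      ∫ r in (0 : ℝ)..s, (s - r) ^ (α - 1) * (a * mittagLeffler₂ α 1 (a * r ^ α)) := by
  rcases hs.eq_or_lt with rfl | hs
  · simp [Real.zero_rpow hα.ne', mittagLeffler₂_zero]
  · have h := mittagLeffler₂_volterra hα one_pos hs a
    simp only [sub_self, Real.rpow_zero, one_mul, Real.Gamma_one, div_one] at h
    conv_lhs => rw [h]
    have : ∫ r in (0 : ℝ)..s, (s - r) ^ (α - 1) * (a * mittagLeffler₂ α 1 (a * r ^ α)) =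
        a * ∫ r in (0 : ℝ)..s, (s - r) ^ (α - 1) * mittagLeffler₂ α 1 (a * r ^ α) := by
      rw [← intervalIntegral.integral_const_mul]
      refine intervalIntegral.integral_congr fun r _ => ?_
      ring
    rw [this]
    ring

/-- Comparison principle for the linear Caputo equation. -/
lemma mul_mittagLeffler_le_of_abel_volterra {α T a u₀ : ℝ} (hα : 0 < α) (hα1 : α ≤ 1)
    (hT : 0 < T) {u g : ℝ → ℝ} (hu : ContinuousOn u (Icc 0 T)) (hg : ContinuousOn g (Icc 0 T))
    (heq : ∀ s ∈ Icc 0 T,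
      u s = u₀ + 1 / Real.Gamma α * ∫ r in (0 : ℝ)..s, (s - r) ^ (α - 1) * g r)
    (hle : ∀ s ∈ Ioo 0 T, a * u s ≤ g s) : u₀ * mittagLeffler α (a * T ^ α) ≤ u T := by
  set v : ℝ → ℝ := fun s => mittagLeffler₂ α 1 (a * s ^ α) with hv
  have hvc : Continuous v :=
    (continuous_mittagLeffler₂ hα one_pos).comp
      ((Real.continuous_rpow_const hα.le).const_mul a)
  have hki : ∀ {s : ℝ}, IntervalIntegrable (fun r => (s - r) ^ (α - 1)) volume 0 s := by
    intro s
    have := (intervalIntegral.intervalIntegrable_rpow' (a := s) (b := 0)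
      (show -1 < α - 1 by linarith)).comp_sub_left s
    simpa using this
  have h := nonneg_of_abel_volterra hα hα1 hT (a := a) (q := fun s => g s - u₀ * (a * v s))
    (w := fun s => u s - u₀ * v s)
    (hg.sub ((hvc.const_mul a).const_mul u₀).continuousOn)
    (hu.sub (hvc.const_mul u₀).continuousOn) ?_ ?_
  · have hml : mittagLeffler α (a * T ^ α) = v T := rfl
    rw [hml]
    linarith
  · intro s hs
    have hgi : IntervalIntegrable (fun r => (s - r) ^ (α - 1) * g r) volume 0 s :=
      hki.mul_continuousOn (by rw [uIcc_of_le hs.1]; exact hg.mono (Icc_subset_Icc_right hs.2))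
    have hvi : IntervalIntegrable (fun r => (s - r) ^ (α - 1) * (a * v r)) volume 0 s :=
      hki.mul_continuousOn (hvc.const_mul a).continuousOn
    have hsplit : ∫ r in (0 : ℝ)..s, (s - r) ^ (α - 1) * (g r - u₀ * (a * v r)) =
        (∫ r in (0 : ℝ)..s, (s - r) ^ (α - 1) * g r) -
          u₀ * ∫ r in (0 : ℝ)..s, (s - r) ^ (α - 1) * (a * v r) := by
      rw [← intervalIntegral.integral_const_mul,
        ← intervalIntegral.integral_sub hgi (hvi.const_mul u₀)]
      refine intervalIntegral.integral_congr fun r _ => ?_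
      ring
    have hvs : v s = _ := mittagLeffler₂_one_volterra hα hs.1 a
    rw [hsplit, heq s hs, hvs]
    ring
  · intro s hs
    have := hle s hs
    linarith

lemma le_mul_mittagLeffler_of_abel_volterra {α T a u₀ : ℝ} (hα : 0 < α) (hα1 : α ≤ 1)
    (hT : 0 < T) {u g : ℝ → ℝ} (hu : ContinuousOn u (Icc 0 T)) (hg : ContinuousOn g (Icc 0 T))
    (heq : ∀ s ∈ Icc 0 T,
      u s = u₀ + 1 / Real.Gamma α * ∫ r in (0 : ℝ)..s, (s - r) ^ (α - 1) * g r)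
    (hle : ∀ s ∈ Ioo 0 T, g s ≤ a * u s) : u T ≤ u₀ * mittagLeffler α (a * T ^ α) := by
  have h := mul_mittagLeffler_le_of_abel_volterra hα hα1 hT (a := a) (u₀ := -u₀) hu.neg hg.neg
    (fun s hs => ?_) fun s hs => ?_
  · simp only [Pi.neg_apply] at h
    linarith
  · simp only [Pi.neg_apply, mul_neg, intervalIntegral.integral_neg, heq s hs]
    ring
  · simp only [Pi.neg_apply]
    linarith [hle s hs]

/-- For a negative initial value `x₀ < 0`, the solution `φ(·,x₀)` satisfies
`x₀·E_α(a^*(t)·t^α) ≤ φ(t,x₀) ≤ x₀·E_α(a_*(t)·t^α)` on `[0,T]`. -/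
theorem caputo_nonlinear_bounds_neg (α T : ℝ) (hα : 0 < α) (hα1 : α ≤ 1) (hT : 0 < T)
    (f : ℝ → ℝ → ℝ)
    (hf : ContinuousOn (fun p : ℝ × ℝ => f p.1 p.2) (Set.Icc 0 T ×ˢ Set.univ))
    (L : ℝ → ℝ) (hLc : ContinuousOn L (Set.Icc 0 T))
    (hLnn : ∀ t ∈ Set.Icc 0 T, 0 ≤ L t)
    (hLip : ∀ t ∈ Set.Icc 0 T, ∀ x y : ℝ, |f t x - f t y| ≤ L t * |x - y|)
    (hf0 : ∀ t ∈ Set.Icc 0 T, f t 0 = 0)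
    (x₀ : ℝ) (hx₀ : x₀ < 0) (φ : ℝ → ℝ) (hφ : IsCaputoSolution α T f x₀ φ) :
    ∀ t ∈ Set.Icc 0 T,
      x₀ * mittagLeffler α (aHigh f t * t ^ α) ≤ φ t ∧
        φ t ≤ x₀ * mittagLeffler α (aLow f t * t ^ α) := by
  obtain ⟨hφc, hφeq⟩ := hφ
  have hgc : ContinuousOn (fun s => f s (φ s)) (Icc 0 T) :=
    hf.comp (continuousOn_id.prodMk hφc) fun s hs => ⟨hs, mem_univ _⟩
  have hφ0 : φ 0 = x₀ := by simpa using hφeq 0 ⟨le_rfl, hT.le⟩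
  obtain ⟨C, hC⟩ := isCompact_Icc.exists_bound_of_continuousOn hLc
  have hquot : ∀ s ∈ Icc 0 T, ∀ x : ℝ, x ≠ 0 → |f s x / x| ≤ C := by
    intro s hs x hx
    have h := hLip s hs x 0
    rw [hf0 s hs, sub_zero, sub_zero] at h
    rw [abs_div, div_le_iff₀ (abs_pos.2 hx)]
    refine h.trans (mul_le_mul_of_nonneg_right ?_ (abs_nonneg x))
    exact (le_abs_self _).trans (hC s hs)
  intro t ht
  rcases ht.1.eq_or_lt with rfl | ht0
  · have : mittagLeffler α 0 = 1 := (mittagLeffler₂_zero α 1).trans (by simp)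
    simp [Real.zero_rpow hα.ne', this, hφ0]
  have hsub : Icc 0 t ⊆ Icc 0 T := Icc_subset_Icc_right ht.2
  have hlow : ∀ s ∈ Icc 0 t, ∀ x : ℝ, x ≠ 0 → aLow f t ≤ f s x / x := by
    intro s hs x hx
    refine csInf_le ⟨-C, ?_⟩ ⟨s, hs, x, hx, rfl⟩
    rintro _ ⟨r, hr, z, hz, rfl⟩
    exact (abs_le.1 (hquot r (hsub hr) z hz)).1
  have hhigh : ∀ s ∈ Icc 0 t, ∀ x : ℝ, x ≠ 0 → f s x / x ≤ aHigh f t := by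
    intro s hs x hx
    refine le_csSup ⟨C, ?_⟩ ⟨s, hs, x, hx, rfl⟩
    rintro _ ⟨r, hr, z, hz, rfl⟩
    exact (abs_le.1 (hquot r (hsub hr) z hz)).2
  have hneg : ∀ s ∈ Icc 0 t, φ s < 0 := by
    by_contra! hcon
    obtain ⟨s, hs, hφs⟩ := hcon
    obtain ⟨τ, ⟨hτ, hφτ⟩, hfirst⟩ := exists_first_nonpos
      (hφc.neg.mono (Icc_subset_Icc_right (hs.2.trans ht.2))) hs.1 (by simpa using hφs)
    simp only [Pi.neg_apply, Left.neg_nonpos_iff, Left.neg_pos_iff] at hφτ hfirst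
    have hτ0 : 0 < τ := hτ.1.lt_of_ne fun h => by rw [← h, hφ0] at hφτ; linarith
    have hτt : τ ≤ t := hτ.2.trans hs.2
    have hsubτ : Icc 0 τ ⊆ Icc 0 T := Icc_subset_Icc_right (hτt.trans ht.2)
    have h := le_mul_mittagLeffler_of_abel_volterra hα hα1 hτ0 (a := aLow f t)
      (hφc.mono hsubτ) (hgc.mono hsubτ) (fun r hr => hφeq r (hsubτ hr)) fun r hr => by
        have hr' := hfirst r ⟨hr.1.le, hr.2⟩
        have := hlow r ⟨hr.1.le, hr.2.le.trans hτt⟩ (φ r) hr'.ne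
        rwa [le_div_iff_of_neg hr'] at this
    have hpos : 0 < mittagLeffler α (aLow f t * τ ^ α) := mittagLeffler₂_pos hα hα1 hα1 _
    nlinarith
  constructor
  · refine mul_mittagLeffler_le_of_abel_volterra hα hα1 ht0 (hφc.mono hsub) (hgc.mono hsub)
      (fun s hs => hφeq s (hsub hs)) fun s hs => ?_
    have hs' := Ioo_subset_Icc_self hs
    have := hhigh s hs' (φ s) (hneg s hs').ne
    rwa [div_le_iff_of_neg (hneg s hs')] at this
  · refine le_mul_mittagLeffler_of_abel_volterra hα hα1 ht0 (hφc.mono hsub) (hgc.mono hsub)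
      (fun s hs => hφeq s (hsub hs)) fun s hs => ?_
    have hs' := Ioo_subset_Icc_self hs
    have := hlow s hs' (φ s) (hneg s hs').ne
    rwa [le_div_iff_of_neg (hneg s hs')] at this
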